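/- (Linearly ordered divided Archimedean scales are measurable) Let ρ : A → L be a basic scaling whose codomain L is linearly ordered. Assume ρ is divided, and Archimedean in the sense that there is no δ in the image of ρ with ρ(0) < δ for which some infinite pairwise disjoint subset X of A satisfies δ ≤ ρ(x) for all x ∈ X. Then there exists m : A → ℝ such that m(0) = 0, m(x ∨ y) = m(x) + m(y) whenever x ∧ y = 0, and for all x, y ∈ A, m(x) ≤ m(y) if and only if ρ(x) ≤ ρ(y). -/

import Mathlib

/-- A *basic scaling* is a strictly increasing map from a Boolean algebra to a
partially ordered set that preserves relative complementation. -/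
structure IsBasicScaling {A P : Type*} [BooleanAlgebra A] [PartialOrder P]
    (ρ : A → P) : Prop where
  mono : ∀ x y : A, x < y → ρ x < ρ y
  relcomp_lt : ∀ a b x y : A, a ≤ x → x ≤ b → a ≤ y → y ≤ b →
      ρ x < ρ y → ρ (a ⊔ (b ⊓ yᶜ)) < ρ (a ⊔ (b ⊓ xᶜ))
  relcomp_eq : ∀ a b x y : A, a ≤ x → x ≤ b → a ≤ y → y ≤ b →
      ρ x = ρ y → ρ (a ⊔ (b ⊓ xᶜ)) = ρ (a ⊔ (b ⊓ yᶜ))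

/-- A basic scaling is *divided* if whenever `ρ x < ρ y` there is `y₁ < y`
with `ρ y₁ = ρ x`. -/
def Divided {A P : Type*} [BooleanAlgebra A] [PartialOrder P] (ρ : A → P) : Prop :=
  ∀ x y : A, ρ x < ρ y → ∃ y₁, y₁ < y ∧ ρ y₁ = ρ x

open Filter Topology

namespace IsBasicScaling

variable {A L : Type*} [BooleanAlgebra A] [LinearOrder L] {ρ : A → L}

theorem monotone (h : IsBasicScaling ρ) : Monotone ρ := fun x y hxy => by
  rcases hxy.eq_or_lt with rfl | hlt
  · exact le_rfl
  · exact (h.mono _ _ hlt).le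

theorem lt_sup_right (h : IsBasicScaling ρ) {x y z : A} (hx : Disjoint x z) (hy : Disjoint y z)
    (hxy : ρ x < ρ y) : ρ (x ⊔ z) < ρ (y ⊔ z) := by
  have h₁ := h.relcomp_lt ⊥ zᶜ x y bot_le hx.le_compl_right bot_le hy.le_compl_right hxy
  have h₂ := h.relcomp_lt ⊥ ⊤ _ _ bot_le le_top bot_le le_top h₁
  simpa [compl_inf, sup_comm] using h₂

theorem eq_sup_right (h : IsBasicScaling ρ) {x y z : A} (hx : Disjoint x z) (hy : Disjoint y z)
    (hxy : ρ x = ρ y) : ρ (x ⊔ z) = ρ (y ⊔ z) := by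
  have h₁ := h.relcomp_eq ⊥ zᶜ x y bot_le hx.le_compl_right bot_le hy.le_compl_right hxy
  have h₂ := h.relcomp_eq ⊥ ⊤ _ _ bot_le le_top bot_le le_top h₁
  simpa [compl_inf, sup_comm] using h₂

theorem le_sup_right (h : IsBasicScaling ρ) {x y z : A} (hx : Disjoint x z) (hy : Disjoint y z)
    (hxy : ρ x ≤ ρ y) : ρ (x ⊔ z) ≤ ρ (y ⊔ z) := by
  rcases hxy.eq_or_lt with he | hlt
  · exact (h.eq_sup_right hx hy he).le
  · exact (h.lt_sup_right hx hy hlt).le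

/-- Joins of disjoint pairs are compared componentwise, strictly if one comparison is strict. -/
theorem sup_lt_sup (h : IsBasicScaling ρ) {a b c d : A} (hab : Disjoint a b) (hcd : Disjoint c d)
    (hac : ρ a ≤ ρ c) (hbd : ρ b < ρ d) : ρ (a ⊔ b) < ρ (c ⊔ d) := by
  have h₁ : ρ (b ⊔ a \ d) < ρ (d ⊔ a \ d) :=
    h.lt_sup_right (hab.symm.mono_right sdiff_le) disjoint_sdiff_self_right hbd
  have h₂ : ρ (a ⊔ d \ a) ≤ ρ (c ⊔ d \ a) :=
    h.le_sup_right disjoint_sdiff_self_right (hcd.mono_right sdiff_le) hac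
  have h₃ : ρ (b ⊔ a \ d) < ρ (c ⊔ d \ a) := by
    refine h₁.trans_le (le_of_eq_of_le ?_ h₂)
    rw [sup_sdiff_self_right, sup_sdiff_self_right, sup_comm]
  have h₄ := h.lt_sup_right (z := a ⊓ d)
    ((hab.symm.mono_right inf_le_left).sup_left (disjoint_sdiff_self_left.mono_right inf_le_right))
    ((hcd.mono_right inf_le_right).sup_left (disjoint_sdiff_self_left.mono_right inf_le_left)) h₃
  have e₁ : b ⊔ a \ d ⊔ a ⊓ d = a ⊔ b := by
    rw [sup_assoc, sup_comm (a \ d), sup_inf_sdiff, sup_comm]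
  have e₂ : c ⊔ d \ a ⊔ a ⊓ d = c ⊔ d := by
    rw [sup_assoc, sup_comm (d \ a), inf_comm, sup_inf_sdiff]
  rwa [e₁, e₂] at h₄

theorem bot_lt (h : IsBasicScaling ρ) {x : A} (hx : x ≠ ⊥) : ρ ⊥ < ρ x :=
  h.mono _ _ (bot_lt_iff_ne_bot.2 hx)

end IsBasicScaling

theorem Divided.exists_le {A L : Type*} [BooleanAlgebra A] [LinearOrder L] {ρ : A → L}
    (hdiv : Divided ρ) {x y : A} (hxy : ρ x ≤ ρ y) : ∃ c ≤ y, ρ c = ρ x := by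
  rcases hxy.eq_or_lt with he | hlt
  · exact ⟨y, le_rfl, he.symm⟩
  · obtain ⟨c, hc, hcx⟩ := hdiv x y hlt
    exact ⟨c, hc.le, hcx⟩

/-- `Packs ρ e n x` says that `x` is the disjoint join of `n` elements of the same `ρ`-value as `e`
and a remainder of strictly smaller value. -/
inductive Packs {A L : Type*} [BooleanAlgebra A] [LinearOrder L] (ρ : A → L) (e : A) :
    ℕ → A → Prop
  | small {x : A} : ρ x < ρ e → Packs ρ e 0 x
  | step {n : ℕ} {c x : A} : Disjoint c x → ρ c = ρ e → Packs ρ e n x → Packs ρ e (n + 1) (c ⊔ x)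

section Packs

variable {A L : Type*} [BooleanAlgebra A] [LinearOrder L] {ρ : A → L} {e : A}

theorem Packs.le_of_succ (h : IsBasicScaling ρ) {n : ℕ} {x : A} (hp : Packs ρ e (n + 1) x) :
    ρ e ≤ ρ x := by
  cases hp with
  | step _ hc _ => exact hc ▸ h.monotone le_sup_left

theorem Packs.lt_of_lt (h : IsBasicScaling ρ) {n k : ℕ} {x y : A} (hx : Packs ρ e n x)
    (hy : Packs ρ e k y) (hnk : n < k) : ρ x < ρ y := by
  induction hx generalizing k y with
  | small hx =>
    obtain ⟨k, rfl⟩ := Nat.exists_eq_succ_of_ne_zero hnk.ne'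
    exact hx.trans_le (hy.le_of_succ h)
  | step hd hc _ ih =>
    cases hy with
    | small => omega
    | step hd' hc' hy' => exact h.sup_lt_sup hd hd' (hc.trans hc'.symm).le (ih hy' (by omega))

theorem Packs.le_of_le (h : IsBasicScaling ρ) {n k : ℕ} {x y : A} (hx : Packs ρ e n x)
    (hy : Packs ρ e k y) (hxy : ρ x ≤ ρ y) : n ≤ k := by
  by_contra! hlt
  exact (hy.lt_of_lt h hx hlt).not_ge hxy

theorem Packs.sup (h : IsBasicScaling ρ) (hdiv : Divided ρ) {n k : ℕ} {x y : A}
    (hx : Packs ρ e n x) (hy : Packs ρ e k y) (hxy : Disjoint x y) :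
    Packs ρ e (n + k) (x ⊔ y) ∨ Packs ρ e (n + k + 1) (x ⊔ y) := by
  induction hx with
  | @step n c x hd hc _ ih =>
    rw [disjoint_sup_left] at hxy
    rw [sup_assoc, Nat.add_right_comm n 1 k]
    have hd' : Disjoint c (x ⊔ y) := hd.sup_right hxy.1
    exact (ih hxy.2).imp (.step hd' hc) (.step hd' hc)
  | @small x hx =>
    induction hy with
    | @step k c y hd hc _ ih =>
      rw [disjoint_sup_right] at hxy
      rw [sup_left_comm, ← add_assoc]
      have hd' : Disjoint c (x ⊔ y) := hxy.1.symm.sup_right hd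
      exact (ih hxy.2).imp (.step hd' hc) (.step hd' hc)
    | @small y hy =>
      rcases lt_or_ge (ρ (x ⊔ y)) (ρ e) with hlt | hge
      · exact .inl (.small hlt)
      · obtain ⟨c, hcle, hc⟩ := hdiv.exists_le hge
        right
        rw [← sup_sdiff_cancel_right hcle]
        refine .step disjoint_sdiff_self_right hc (.small ?_)
        by_contra! hr
        have := h.sup_lt_sup hxy disjoint_sdiff_self_right (hx.le.trans hc.ge) (hy.trans_le hr)
        rw [sup_sdiff_cancel_right hcle] at this
        exact this.false

/-- If `e` has the least positive value, remainders vanish and packings add up exactly. -/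
theorem Packs.sup_of_minimal (hmin : ∀ x : A, x ≠ ⊥ → ρ e ≤ ρ x)
    {n k : ℕ} {x y : A} (hx : Packs ρ e n x) (hy : Packs ρ e k y) (hxy : Disjoint x y) :
    Packs ρ e (n + k) (x ⊔ y) := by
  induction hx with
  | @step n c x hd hc _ ih =>
    rw [disjoint_sup_left] at hxy
    rw [sup_assoc, Nat.add_right_comm n 1 k]
    exact .step (hd.sup_right hxy.1) hc (ih hxy.2)
  | @small x hx =>
    have : x = ⊥ := by
      by_contra hne
      exact (hmin x hne).not_gt hx
    simpa [this] using hy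

theorem exists_packs (h : IsBasicScaling ρ) (hdiv : Divided ρ)
    (harch : ¬ ∃ (y : A) (X : Set A), ρ ⊥ < ρ y ∧ X.Infinite ∧
      X.Pairwise (fun x x' => x ⊓ x' = ⊥) ∧ ∀ x ∈ X, ρ y ≤ ρ x)
    (he : e ≠ ⊥) (x : A) : ∃ n, Packs ρ e n x := by
  by_contra hx
  let S := {y : A // ¬ ∃ n, Packs ρ e n y}
  have step (y : S) : ∃ c ≤ y.1, ρ c = ρ e ∧ ¬ ∃ n, Packs ρ e n (y.1 \ c) := by
    have hge : ρ e ≤ ρ y.1 := by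
      by_contra! hlt
      exact y.2 ⟨0, .small hlt⟩
    obtain ⟨c, hcle, hc⟩ := hdiv.exists_le hge
    refine ⟨c, hcle, hc, fun ⟨n, hn⟩ => y.2 ⟨n + 1, ?_⟩⟩
    simpa [sup_sdiff_cancel_right hcle] using Packs.step disjoint_sdiff_self_right hc hn
  choose c hcle hc hrest using step
  let r : ℕ → S := fun k => Nat.rec ⟨x, hx⟩ (fun _ y => ⟨y.1 \ c y, hrest y⟩) k
  have hr (k : ℕ) : (r (k + 1)).1 = (r k).1 \ c (r k) := rfl
  have hanti : Antitone fun k => (r k).1 := antitone_nat_of_succ_le fun k => by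
    rw [hr]; exact sdiff_le
  have hdisj {i j : ℕ} (hij : i < j) : Disjoint (c (r i)) (c (r j)) := by
    have hle : c (r j) ≤ (r i).1 \ c (r i) := (hcle (r j)).trans ((hanti hij).trans_eq (hr i))
    exact disjoint_sdiff_self_right.mono_right hle
  have hpair : Pairwise fun i j => Disjoint (c (r i)) (c (r j)) := fun i j hij =>
    hij.lt_or_gt.elim hdisj fun hlt => (hdisj hlt).symm
  have hne (k : ℕ) : c (r k) ≠ ⊥ := fun h0 => by
    have := h.bot_lt he
    rw [← hc (r k), h0] at this
    exact this.false
  have hinj : Function.Injective fun k => c (r k) := fun i j hij => by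
    by_contra hne'
    have hd : Disjoint (c (r i)) (c (r j)) := hpair hne'
    simp only at hij
    rw [hij, disjoint_self] at hd
    exact hne j hd
  refine harch ⟨e, Set.range fun k => c (r k), h.bot_lt he, Set.infinite_range_of_injective hinj,
    ?_, ?_⟩
  · rintro _ ⟨i, rfl⟩ _ ⟨j, rfl⟩ hij
    exact (hpair fun hij' => hij (by rw [hij'])).eq_bot
  · rintro _ ⟨i, rfl⟩
    exact (hc _).ge

/-- A nonzero additive functional that is monotone in `ρ` represents `ρ`. -/
theorem le_iff_of_additive_of_monotone (hdiv : Divided ρ)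
    (hpack : ∀ e : A, e ≠ ⊥ → ∀ x, ∃ n, Packs ρ e n x) {m : A → ℝ} (htop : 0 < m ⊤)
    (hadd : ∀ x y : A, Disjoint x y → m (x ⊔ y) = m x + m y)
    (hmono : ∀ x y : A, ρ x ≤ ρ y → m x ≤ m y) (x y : A) : m x ≤ m y ↔ ρ x ≤ ρ y := by
  refine ⟨fun hm => ?_, hmono x y⟩
  by_contra! hlt
  obtain ⟨w, hw, hwy⟩ := hdiv y x hlt
  have hz : x \ w ≠ ⊥ := fun h0 => hw.not_ge (sdiff_eq_bot_iff.1 h0)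
  have hx := hadd w (x \ w) disjoint_sdiff_self_right
  rw [sup_sdiff_cancel_right hw.le] at hx
  have hwm := hmono _ _ hwy.ge
  have bound {n : ℕ} {t : A} (ht : Packs ρ (x \ w) n t) : m t ≤ (n + 1) * m (x \ w) := by
    induction ht with
    | small ht => simpa using hmono _ _ ht.le
    | step hd hc _ ih =>
      have := hmono _ _ hc.le
      rw [hadd _ _ hd]
      push_cast
      linarith
  obtain ⟨n, hn⟩ := hpack _ hz ⊤
  have hpos : 0 < (n + 1 : ℝ) * m (x \ w) := htop.trans_le (bound hn)
  have := pos_of_mul_pos_right hpos (by positivity)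
  linarith

end Packs

theorem stmt_18 {A L : Type*} [BooleanAlgebra A] [LinearOrder L] (ρ : A → L)
    (h : IsBasicScaling ρ) (hdiv : Divided ρ)
    (harch : ¬ ∃ (y : A) (X : Set A), ρ ⊥ < ρ y ∧ X.Infinite ∧
      X.Pairwise (fun x x' => x ⊓ x' = ⊥) ∧ ∀ x ∈ X, ρ y ≤ ρ x) :
    ∃ m : A → ℝ, m ⊥ = 0 ∧
      (∀ x y : A, x ⊓ y = ⊥ → m (x ⊔ y) = m x + m y) ∧
      (∀ x y : A, m x ≤ m y ↔ ρ x ≤ ρ y) := by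
  have hpack (e : A) (he : e ≠ ⊥) (x : A) : ∃ n, Packs ρ e n x := exists_packs h hdiv harch he x
  rcases subsingleton_or_nontrivial A with hs | hnt
  · exact ⟨fun _ => 0, rfl, by simp, fun x y => by simp [Subsingleton.elim x y]⟩
  suffices hm : ∃ m : A → ℝ, 0 < m ⊤ ∧ (∀ x y : A, Disjoint x y → m (x ⊔ y) = m x + m y) ∧
      ∀ x y : A, ρ x ≤ ρ y → m x ≤ m y by
    obtain ⟨m, htop, hadd, hmono⟩ := hm
    refine ⟨m, ?_, fun x y hxy => hadd x y (disjoint_iff.2 hxy),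
      le_iff_of_additive_of_monotone hdiv hpack htop hadd hmono⟩
    simpa using hadd ⊥ ⊥ disjoint_bot_left
  choose! N hN using hpack
  have N_mono {e : A} (he : e ≠ ⊥) {x y : A} (hxy : ρ x ≤ ρ y) : N e x ≤ N e y :=
    (hN e he x).le_of_le h (hN e he y) hxy
  have N_eq {e : A} (he : e ≠ ⊥) {x : A} {n : ℕ} (hn : Packs ρ e n x) : N e x = n :=
    le_antisymm ((hN e he x).le_of_le h hn le_rfl) (hn.le_of_le h (hN e he x) le_rfl)
  have N_sup {e : A} (he : e ≠ ⊥) {x y : A} (hxy : Disjoint x y) :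
      N e x + N e y ≤ N e (x ⊔ y) ∧ N e (x ⊔ y) ≤ N e x + N e y + 1 := by
    rcases (hN e he x).sup h hdiv (hN e he y) hxy with hp | hp <;> rw [N_eq he hp] <;> omega
  have N_pos {e : A} (he : e ≠ ⊥) {x : A} (hx : ρ e ≤ ρ x) : 0 < N e x := by
    by_contra! h0
    have hp := hN e he x
    rw [Nat.le_zero.1 h0] at hp
    cases hp with
    | small hlt => exact hlt.not_ge hx
  by_cases hmin : ∃ e : A, e ≠ ⊥ ∧ ∀ x : A, x ≠ ⊥ → ρ e ≤ ρ x
  · obtain ⟨e, he, hmin⟩ := hmin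
    refine ⟨fun x => N e x, ?_, fun x y hxy => ?_, fun x y hxy => ?_⟩
    · beta_reduce
      exact_mod_cast N_pos he (h.monotone le_top)
    · beta_reduce
      exact_mod_cast N_eq he ((hN e he x).sup_of_minimal hmin (hN e he y) hxy)
    · beta_reduce
      exact_mod_cast N_mono he hxy
  push Not at hmin
  have hunbdd (k : ℕ) : ∃ e : A, e ≠ ⊥ ∧ k + 1 ≤ N e ⊤ := by
    induction k with
    | zero => exact ⟨⊤, top_ne_bot, N_pos top_ne_bot le_rfl⟩
    | succ k ih =>
      obtain ⟨e, he, hk⟩ := ih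
      obtain ⟨x, hx, hxe⟩ := hmin e he
      obtain ⟨u, hue, hux⟩ := hdiv x e hxe
      have hu : u ≠ ⊥ := fun h0 => by
        have := h.bot_lt hx
        rw [← hux, h0] at this
        exact this.false
      have hv : e \ u ≠ ⊥ := fun h0 => hue.not_ge (sdiff_eq_bot_iff.1 h0)
      obtain ⟨d, hd, hdu, hdv⟩ : ∃ d : A, d ≠ ⊥ ∧ ρ d ≤ ρ u ∧ ρ d ≤ ρ (e \ u) := by
        rcases le_total (ρ u) (ρ (e \ u)) with hle | hle
        · exact ⟨u, hu, le_rfl, hle⟩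
        · exact ⟨e \ u, hv, hle, le_rfl⟩
      have htwo : 2 ≤ N d e := by
        have h₁ := (N_sup hd (disjoint_sdiff_self_right (x := u) (y := e))).1
        rw [sup_sdiff_cancel_right hue.le] at h₁
        have := N_pos hd hdu
        have := N_pos hd hdv
        omega
      have hdouble {n : ℕ} {y : A} (hy : Packs ρ e n y) : 2 * n ≤ N d y := by
        induction hy with
        | small => simp
        | step hcy hc _ ih =>
          have := (N_sup hd hcy).1
          have := N_mono hd hc.ge
          omega
      have := hdouble (hN e he ⊤)
      exact ⟨d, hd, by omega⟩
  choose e he hbig using hunbdd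
  let f (x : A) (k : ℕ) : ℝ := N (e k) x / N (e k) ⊤
  have hpos (k : ℕ) : (0 : ℝ) < N (e k) ⊤ := by
    have := hbig k
    exact_mod_cast (by omega : 0 < N (e k) ⊤)
  have hf (x : A) : ∃ a, Tendsto (f x) (hyperfilter ℕ) (𝓝 a) := by
    obtain ⟨a, -, ha⟩ := (isCompact_Icc (a := (0 : ℝ)) (b := 1)).ultrafilter_le_nhds
      ((hyperfilter ℕ).map (f x)) (by
        rw [Ultrafilter.coe_map, le_principal_iff]
        refine mem_map.2 (Eventually.of_forall fun k => ⟨by positivity, ?_⟩)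
        rw [div_le_one (hpos k)]
        exact_mod_cast N_mono (he k) (h.monotone le_top))
    exact ⟨a, ha⟩
  choose m hm using hf
  refine ⟨m, ?_, fun x y hxy => ?_, fun x y hxy => ?_⟩
  · have : Tendsto (f ⊤) (hyperfilter ℕ) (𝓝 1) :=
      tendsto_const_nhds.congr fun k => (div_self (hpos k).ne').symm
    rw [tendsto_nhds_unique (hm ⊤) this]
    exact one_pos
  · have hlim := (hm (x ⊔ y)).sub ((hm x).add (hm y))
    have hzero : Tendsto (fun k => f (x ⊔ y) k - (f x k + f y k)) (hyperfilter ℕ) (𝓝 0) := by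
      have hinv : Tendsto (fun k : ℕ => 1 / ((k : ℝ) + 1)) (hyperfilter ℕ) (𝓝 0) :=
        tendsto_one_div_add_atTop_nhds_zero_nat.mono_left Nat.hyperfilter_le_atTop
      refine squeeze_zero (fun k => ?_) (fun k => ?_) hinv
      · have hle : ((N (e k) x : ℝ) + N (e k) y) ≤ N (e k) (x ⊔ y) := by
          exact_mod_cast (N_sup (he k) hxy).1
        rw [← add_div, ← sub_div]
        exact div_nonneg (sub_nonneg.2 hle) (hpos k).le
      · have hle : (N (e k) (x ⊔ y) : ℝ) ≤ N (e k) x + N (e k) y + 1 := by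
          exact_mod_cast (N_sup (he k) hxy).2
        have hk : (k : ℝ) + 1 ≤ N (e k) ⊤ := by exact_mod_cast hbig k
        rw [← add_div, ← sub_div]
        exact div_le_div₀ zero_le_one (by linarith) (by positivity) hk
    exact sub_eq_zero.1 (tendsto_nhds_unique hlim hzero)
  · refine le_of_tendsto_of_tendsto' (hm x) (hm y) fun k => ?_
    have : (N (e k) x : ℝ) ≤ N (e k) y := by exact_mod_cast N_mono (he k) hxy
    exact div_le_div_of_nonneg_right this (hpos k).le
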